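/- Let n ≥ 2, μ < 1/4, p > p_c := 1 + 2/(n−2+α₊) and R > 0. Then there is no positive u ∈ C²(ℝⁿ₊ ∩ B_R(0)) with Δu + (μ/x₁²)u = u^p on ℝⁿ₊ ∩ B_R(0) satisfying both: (a) u(x) ≤ c x₁^{α₊} |x|^{−α₊−2/(p−1)} for all x ∈ ℝⁿ₊ ∩ B_R(0), for some c > 0; and (b) a nontangential lower bound at the origin: there exist κ ∈ (0,1), c' > 0 and δ > 0 such that u(x) ≥ c' |x|^{−2/(p−1)} for all x ∈ ℝⁿ₊ with x₁ ≥ κ|x| and 0 < |x| < δ. -/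

import Mathlib

open Real Set

noncomputable def lap {n : ℕ} (u : EuclideanSpace ℝ (Fin n) → ℝ)
    (x : EuclideanSpace ℝ (Fin n)) : ℝ :=
  ∑ i : Fin n, iteratedFDeriv ℝ 2 u x ![EuclideanSpace.single i 1, EuclideanSpace.single i 1]

noncomputable def x1 {n : ℕ} (x : EuclideanSpace ℝ (Fin n)) : ℝ :=
  if h : 0 < n then x ⟨0, h⟩ else 0

def halfSpace (n : ℕ) : Set (EuclideanSpace ℝ (Fin n)) := {x | 0 < x1 x}

noncomputable def aPlus (μ : ℝ) : ℝ := 1 / 2 + Real.sqrt (1 / 4 - μ)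

noncomputable def aMinus (μ : ℝ) : ℝ := 1 / 2 - Real.sqrt (1 / 4 - μ)

noncomputable def Lam (n : ℕ) (s : ℝ) : ℝ := s * (s + n - 2)

open Filter Topology

theorem slice_deriv2 {E : Type*} [NormedAddCommGroup E] [NormedSpace ℝ E] {f : E → ℝ} {x : E}
    (hf : ContDiffAt ℝ 2 f x) (e : E) :
    iteratedFDeriv ℝ 2 f x ![e, e] = deriv (deriv (fun t : ℝ => f (x + t • e))) 0 := by
  have hline : ∀ t : ℝ, HasDerivAt (fun t : ℝ => x + t • e) e t := by
    intro t
    simpa using ((hasDerivAt_id t).smul_const e).const_add x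
  have hcont : Tendsto (fun t : ℝ => x + t • e) (𝓝 0) (𝓝 x) := by
    have := (hline 0).continuousAt.tendsto
    simpa using this
  have h1 : ∀ᶠ y in 𝓝 x, DifferentiableAt ℝ f y := by
    filter_upwards [hf.eventually (by simp)] with y hy
    exact hy.differentiableAt (by simp)
  have h2 : deriv (fun t : ℝ => f (x + t • e)) =ᶠ[𝓝 0] fun t => fderiv ℝ f (x + t • e) e := by
    filter_upwards [hcont.eventually h1] with t ht
    exact (ht.hasFDerivAt.comp_hasDerivAt t (hline t)).deriv
  rw [h2.deriv_eq]
  have h3 : DifferentiableAt ℝ (fderiv ℝ f) x :=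
    (hf.fderiv_right (m := 1) (by norm_num)).differentiableAt (by simp)
  have h3' : HasFDerivAt (fderiv ℝ f) (fderiv ℝ (fderiv ℝ f) x) (x + (0:ℝ) • e) := by
    simpa using h3.hasFDerivAt
  have h4 := h3'.comp_hasDerivAt (0:ℝ) (hline 0)
  have h5 := h4.clm_apply (hasDerivAt_const (0:ℝ) e)
  have h6 := h5.deriv
  simp only [Function.comp_def] at h6
  rw [h6, iteratedFDeriv_two_apply]
  simp

theorem deriv2_nonpos {g : ℝ → ℝ} (hg : ContinuousAt g 0) (hm : IsLocalMax g 0) :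
    deriv (deriv g) 0 ≤ 0 := by
  by_contra h
  push Not at h
  have h1 := isLocalMin_of_deriv_deriv_pos h hm.deriv_eq_zero hg
  have h2 : g =ᶠ[𝓝 0] fun _ => g 0 := by
    filter_upwards [hm, h1] with t a b
    exact le_antisymm a b
  have h3 : deriv g =ᶠ[𝓝 0] fun _ => 0 := by
    filter_upwards [h2.eventuallyEq_nhds] with t ht
    rw [ht.deriv_eq]; simp
  rw [h3.deriv_eq] at h
  simp at h

theorem lap_nonpos {n : ℕ} {f : EuclideanSpace ℝ (Fin n) → ℝ} {x : EuclideanSpace ℝ (Fin n)}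
    (hf : ContDiffAt ℝ 2 f x) (hm : IsLocalMax f x) : lap f x ≤ 0 := by
  unfold lap
  refine Finset.sum_nonpos fun i _ => ?_
  rw [slice_deriv2 hf]
  have hc : ContinuousAt (fun t : ℝ => x + t • (EuclideanSpace.single i 1 : EuclideanSpace ℝ (Fin n))) 0 := by
    fun_prop
  refine deriv2_nonpos ?_ ?_
  · refine ContinuousAt.comp (g := f) ?_ hc
    simpa using hf.continuousAt
  · have := hc.tendsto
    simp only [zero_smul, add_zero] at this
    have h2 := this.eventually hm
    filter_upwards [h2] with t ht
    simpa using ht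

theorem lap_eq {n : ℕ} (f : EuclideanSpace ℝ (Fin n) → ℝ) (x : EuclideanSpace ℝ (Fin n)) :
    lap f x = Laplacian.laplacian f x := by
  rw [InnerProductSpace.laplacian_eq_iteratedFDeriv_orthonormalBasis f
    (EuclideanSpace.basisFun (Fin n) ℝ)]
  simp [lap]

theorem oneD (α β a s d b : ℝ) (ha : 0 < a) (hs : 0 < s) :
    deriv (deriv (fun t : ℝ => (a + t * d) ^ α * (s + 2 * b * t + t ^ 2 * 1) ^ β)) 0 =
      a ^ α * s ^ β * (α * (α - 1) * d ^ 2 / a ^ 2 + 4 * α * β * (d * b) / (a * s)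
        + 4 * β * (β - 1) * b ^ 2 / s ^ 2 + 2 * β / s) := by
  have hA : ∀ t : ℝ, HasDerivAt (fun t : ℝ => a + t * d) d t := by
    intro t
    simpa using ((hasDerivAt_id t).mul_const d).const_add a
  have hS : ∀ t : ℝ, HasDerivAt (fun t : ℝ => s + 2 * b * t + t ^ 2 * 1) (2 * b + 2 * t) t := by
    intro t
    have := (((hasDerivAt_id t).const_mul (2 * b)).const_add s).add (((hasDerivAt_id t).pow 2).mul_const 1)
    refine HasDerivAt.congr_deriv this ?_
    simp
  have pA : ∀ᶠ t in 𝓝 (0:ℝ), 0 < a + t * d :=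
    (hA 0).continuousAt.eventually (lt_mem_nhds (by simpa using ha))
  have pS : ∀ᶠ t in 𝓝 (0:ℝ), 0 < s + 2 * b * t + t ^ 2 * 1 :=
    (hS 0).continuousAt.eventually (lt_mem_nhds (by simpa using hs))
  have pw : ∀ γ t : ℝ, 0 < a + t * d →
      HasDerivAt (fun t : ℝ => (a + t * d) ^ γ) (d * γ * (a + t * d) ^ (γ - 1)) t :=
    fun γ t h => (hA t).rpow_const (Or.inl h.ne')
  have qw : ∀ γ t : ℝ, 0 < s + 2 * b * t + t ^ 2 * 1 →
      HasDerivAt (fun t : ℝ => (s + 2 * b * t + t ^ 2 * 1) ^ γ)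
        ((2 * b + 2 * t) * γ * (s + 2 * b * t + t ^ 2 * 1) ^ (γ - 1)) t :=
    fun γ t h => (hS t).rpow_const (Or.inl h.ne')
  have h1 : deriv (fun t : ℝ => (a + t * d) ^ α * (s + 2 * b * t + t ^ 2 * 1) ^ β) =ᶠ[𝓝 0]
      fun t => (d * α * (a + t * d) ^ (α - 1)) * (s + 2 * b * t + t ^ 2 * 1) ^ β +
        (a + t * d) ^ α * ((2 * b + 2 * t) * β * (s + 2 * b * t + t ^ 2 * 1) ^ (β - 1)) := by
    filter_upwards [pA, pS] with t h h'
    exact ((pw α t h).mul (qw β t h')).deriv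
  rw [h1.deriv_eq]
  have zA := pA.self_of_nhds
  have zS := pS.self_of_nhds
  have lin : HasDerivAt (fun t : ℝ => (2 * b + 2 * t) * β) (2 * β) 0 := by
    have := (((hasDerivAt_id (0:ℝ)).const_mul 2).const_add (2 * b)).mul_const β
    simpa using this
  have h2 := (((pw (α - 1) 0 zA).const_mul (d * α)).mul (qw β 0 zS)).add
    ((pw α 0 zA).mul (lin.mul (qw (β - 1) 0 zS)))
  refine h2.deriv.trans ?_
  simp only [Pi.mul_apply, zero_mul, add_zero, mul_zero, ne_eq, OfNat.ofNat_ne_zero, not_false_eq_true, zero_pow]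
  rw [rpow_sub_one ha.ne', rpow_sub_one ha.ne', rpow_sub_one hs.ne' (β - 1), rpow_sub_one hs.ne' β]
  field_simp
  ring

noncomputable def GG {n : ℕ} (α β : ℝ) (x : EuclideanSpace ℝ (Fin n)) : ℝ :=
  x1 x ^ α * (‖x‖ ^ 2) ^ β

theorem x1_pos_ne {n : ℕ} {x : EuclideanSpace ℝ (Fin n)} (hx : 0 < x1 x) : x ≠ 0 := by
  rintro rfl
  simp [x1] at hx

theorem x1_contDiff {n : ℕ} : ContDiff ℝ 2 (x1 : EuclideanSpace ℝ (Fin n) → ℝ) := by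
  unfold x1
  split_ifs
  · fun_prop
  · fun_prop

theorem GG_contDiffAt {n : ℕ} (α β : ℝ) {x : EuclideanSpace ℝ (Fin n)} (hx : 0 < x1 x) :
    ContDiffAt ℝ 2 (GG α β) x := by
  have hx0 : ‖x‖ ^ 2 ≠ 0 := by
    have := x1_pos_ne hx
    positivity
  unfold GG
  exact (x1_contDiff.contDiffAt.rpow_const_of_ne hx.ne').mul
    ((contDiff_norm_sq ℝ).contDiffAt.rpow_const_of_ne hx0)

theorem GG_lap {n : ℕ} (hn : 0 < n) (α β : ℝ) {x : EuclideanSpace ℝ (Fin n)} (hx : 0 < x1 x)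
    (h : β * (2 * α + 2 * β - 2 + n) = 0) :
    lap (GG α β) x = α * (α - 1) / x1 x ^ 2 * GG α β x := by
  have hs : 0 < ‖x‖ ^ 2 := by
    have := x1_pos_ne hx
    positivity
  have key : ∀ i : Fin n, iteratedFDeriv ℝ 2 (GG α β) x
      ![EuclideanSpace.single i 1, EuclideanSpace.single i 1] =
      GG α β x * (α * (α - 1) * (if i = ⟨0, hn⟩ then 1 else 0) / x1 x ^ 2
        + 4 * α * β * (if i = ⟨0, hn⟩ then x1 x else 0) / (x1 x * ‖x‖ ^ 2)
        + 4 * β * (β - 1) * (x i) ^ 2 / (‖x‖ ^ 2) ^ 2 + 2 * β / ‖x‖ ^ 2) := by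
    intro i
    rw [slice_deriv2 (GG_contDiffAt α β hx)]
    have e := oneD α β (x1 x) (‖x‖ ^ 2) (if i = ⟨0, hn⟩ then 1 else 0) (x i) hx hs
    have e2 : (fun t : ℝ => GG α β (x + t • (EuclideanSpace.single i 1 : EuclideanSpace ℝ (Fin n)))) =
        (fun t : ℝ => (x1 x + t * (if i = ⟨0, hn⟩ then 1 else 0)) ^ α *
          (‖x‖ ^ 2 + 2 * x i * t + t ^ 2 * 1) ^ β) := by
      funext t
      unfold GG
      congr 2
      · simp only [x1, hn, dif_pos, PiLp.add_apply, PiLp.smul_apply, PiLp.single_apply, smul_eq_mul]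
        simp [eq_comm]
      · rw [norm_add_sq_real, norm_smul, inner_smul_right]
        simp [EuclideanSpace.inner_single_right]
        ring
    rw [e2, e]
    unfold GG
    by_cases hi : i = ⟨0, hn⟩
    · subst hi
      simp [x1, hn]
    · simp [hi]
  unfold lap
  rw [Finset.sum_congr rfl fun i _ => key i, ← Finset.mul_sum]
  have hsum : ∑ i, (x i) ^ 2 = ‖x‖ ^ 2 := by
    rw [EuclideanSpace.norm_sq_eq]; simp
  simp only [Finset.sum_add_distrib, ← Finset.sum_div, ← Finset.mul_sum, hsum]
  simp only [Finset.sum_ite_eq', Finset.sum_const, Finset.card_univ, Fintype.card_fin,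
    Finset.mem_univ, if_true, nsmul_eq_mul]
  have hx' := hx.ne'
  have hs' := hs.ne'
  generalize ‖x‖ ^ 2 = s at *
  generalize x1 x = a at *
  field_simp
  linear_combination 2 * a ^ 2 * GG α β x * h

/-- Comparison on the truncated half annulus. -/
theorem compare {n : ℕ} {R μ p r R' s : ℝ} (hr : 0 < r) (hR' : R' < R) (hs : 0 < s)
    {u w : EuclideanSpace ℝ (Fin n) → ℝ}
    (hu : ContDiffOn ℝ 2 u (halfSpace n ∩ Metric.ball 0 R))
    (hpos : ∀ x ∈ halfSpace n ∩ Metric.ball 0 R, 0 < u x)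
    (heq : ∀ x ∈ halfSpace n ∩ Metric.ball 0 R,
        lap u x + (μ / (x1 x) ^ 2) * u x = u x ^ p)
    (hw : ∀ x, 0 < x1 x → ContDiffAt ℝ 2 w x)
    (hwp : ∀ x, 0 < x1 x → 0 < w x)
    (hwl : ∀ x, 0 < x1 x → lap w x + (μ / (x1 x) ^ 2) * w x = 0)
    (b1 : ∀ x, 0 < x1 x → ‖x‖ = r → x ∈ Metric.ball 0 R → u x ≤ w x)
    (b2 : ∀ x, 0 < x1 x → ‖x‖ = R' → x ∈ Metric.ball 0 R → u x ≤ w x)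
    (b3 : ∀ x, x1 x = s → r ≤ ‖x‖ → ‖x‖ ≤ R' → x ∈ Metric.ball 0 R → u x ≤ w x)
    (x : EuclideanSpace ℝ (Fin n)) (h1 : s ≤ x1 x) (h2 : r ≤ ‖x‖) (h3 : ‖x‖ ≤ R') :
    u x ≤ w x := by
  have hx1c : Continuous (x1 : EuclideanSpace ℝ (Fin n) → ℝ) := x1_contDiff.continuous
  set K : Set (EuclideanSpace ℝ (Fin n)) := {y | s ≤ x1 y} ∩ {y | r ≤ ‖y‖} ∩ Metric.closedBall 0 R'
    with hK
  have hKc : IsCompact K := (isCompact_closedBall 0 R').inter_left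
    ((isClosed_le continuous_const hx1c).inter (isClosed_le continuous_const continuous_norm))
  have hopen : IsOpen (halfSpace n ∩ Metric.ball (0 : EuclideanSpace ℝ (Fin n)) R) :=
    (isOpen_lt continuous_const hx1c).inter Metric.isOpen_ball
  have hxK : x ∈ K := ⟨⟨h1, h2⟩, by simpa using h3⟩
  have hKsub : ∀ y ∈ K, y ∈ halfSpace n ∩ Metric.ball (0 : EuclideanSpace ℝ (Fin n)) R := by
    rintro y ⟨⟨a, b⟩, c⟩
    refine ⟨lt_of_lt_of_le hs a, ?_⟩
    simp at c ⊢
    linarith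
  have hcd : ∀ y ∈ K, ContDiffAt ℝ 2 u y := fun y hy => hu.contDiffAt (hopen.mem_nhds (hKsub y hy))
  have hcont : ContinuousOn (fun y => u y / w y) K := fun y hy =>
    ((hcd y hy).continuousAt.div (hw y (hKsub y hy).1).continuousAt
      (hwp y (hKsub y hy).1).ne').continuousWithinAt
  obtain ⟨y, hyK, hy⟩ := hKc.exists_isMaxOn ⟨x, hxK⟩ hcont
  have hyS := hKsub y hyK
  have hy1 : 0 < x1 y := hyS.1
  by_contra hlt
  push Not at hlt
  have ht : 1 < u y / w y := by
    refine lt_of_lt_of_le ?_ (hy hxK)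
    rw [one_lt_div (hwp x (hKsub x hxK).1)]
    exact hlt
  have hgt : w y < u y := by rwa [one_lt_div (hwp y hy1)] at ht
  obtain ⟨⟨k1, k2⟩, k3⟩ := id hyK
  simp only [mem_ofPred_eq] at k1 k2
  have k3 : ‖y‖ ≤ R' := by simpa using k3
  have n1 : s < x1 y := lt_of_le_of_ne k1 fun h => absurd (b3 y h.symm k2 k3 hyS.2) (not_le.2 hgt)
  have n2 : r < ‖y‖ := lt_of_le_of_ne k2 fun h => absurd (b1 y hy1 h.symm hyS.2) (not_le.2 hgt)
  have n3 : ‖y‖ < R' := lt_of_le_of_ne k3 fun h => absurd (b2 y hy1 h hyS.2) (not_le.2 hgt)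
  set t := u y / w y with htdef
  have hmax : IsLocalMax (u - t • w) y := by
    have e1 : ∀ᶠ z in 𝓝 y, s < x1 z := hx1c.continuousAt.eventually (lt_mem_nhds n1)
    have e2 : ∀ᶠ z in 𝓝 y, r < ‖z‖ := continuous_norm.continuousAt.eventually (lt_mem_nhds n2)
    have e3 : ∀ᶠ z in 𝓝 y, ‖z‖ < R' := continuous_norm.continuousAt.eventually (gt_mem_nhds n3)
    filter_upwards [e1, e2, e3] with z z1 z2 z3
    have hzK : z ∈ K := ⟨⟨z1.le, z2.le⟩, by simpa using z3.le⟩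
    have hz : u z / w z ≤ t := hy hzK
    rw [div_le_iff₀ (hwp z (hKsub z hzK).1)] at hz
    have hty : u y = t * w y := by
      rw [htdef, div_mul_cancel₀ _ (hwp y hy1).ne']
    simp only [Pi.sub_apply, Pi.smul_apply, smul_eq_mul]
    linarith
  have hwy := hw y hy1
  have htw : ContDiffAt ℝ 2 (t • w) y := contDiffAt_const.smul hwy
  have hle : lap (u - t • w) y ≤ 0 := lap_nonpos ((hcd y hyK).sub htw) hmax
  rw [lap_eq, (hcd y hyK).laplacian_sub htw, InnerProductSpace.laplacian_smul t hwy, ← lap_eq, ← lap_eq, smul_eq_mul] at hle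
  have q1 := heq y hyS
  have q2 := hwl y hy1
  have hty : u y = t * w y := by
    rw [htdef, div_mul_cancel₀ _ (hwp y hy1).ne']
  have q3 : 0 < u y ^ p := rpow_pos_of_pos (hpos y hyS) p
  have q4 : lap u y - t * lap w y = u y ^ p := by
    rw [← q1]
    linear_combination (-t) * q2 - (μ / x1 y ^ 2) * hty
  linarith

/-- for `p > p_c` there is no positive classical solution of
`Δu + (μ/x₁²)u = u^p` on `ℝⁿ₊ ∩ B_R(0)` which is bounded by
`c x₁^{α₊}|x|^{−α₊−2/(p−1)}` and has a nontangential strong singularity at the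
origin. -/
theorem stmt15 (n : ℕ) (hn : 2 ≤ n) (μ p R : ℝ) (hμ : μ < 1 / 4)
    (hpc : 1 + 2 / ((n : ℝ) - 2 + aPlus μ) < p) (hR : 0 < R) :
    ¬ ∃ u : EuclideanSpace ℝ (Fin n) → ℝ,
      ContDiffOn ℝ 2 u (halfSpace n ∩ Metric.ball 0 R) ∧
      (∀ x ∈ halfSpace n ∩ Metric.ball 0 R, 0 < u x) ∧
      (∀ x ∈ halfSpace n ∩ Metric.ball 0 R,
        lap u x + (μ / (x1 x) ^ 2) * u x = u x ^ p) ∧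
      (∃ c > (0 : ℝ), ∀ x ∈ halfSpace n ∩ Metric.ball 0 R,
        u x ≤ c * x1 x ^ aPlus μ * ‖x‖ ^ (-(aPlus μ) - 2 / (p - 1))) ∧
      (∃ κ ∈ Set.Ioo (0 : ℝ) 1, ∃ c' > (0 : ℝ), ∃ δ > (0 : ℝ),
        ∀ x ∈ halfSpace n ∩ Metric.ball 0 R, κ * ‖x‖ ≤ x1 x → ‖x‖ < δ →
          c' * ‖x‖ ^ (-(2 / (p - 1))) ≤ u x) := by
  rintro ⟨u, hu, hpos, heq, ⟨c, hc, hub⟩, ⟨κ, hκ, c', hc', δ, hδ, hlb⟩⟩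
  have hn0 : 0 < n := by omega
  have hn2 : (2:ℝ) ≤ n := by exact_mod_cast hn
  have hsq : 0 < Real.sqrt (1 / 4 - μ) := Real.sqrt_pos.2 (by linarith)
  have hsq2 : Real.sqrt (1 / 4 - μ) ^ 2 = 1 / 4 - μ := Real.sq_sqrt (by linarith)
  have hab : aMinus μ < aPlus μ := by unfold aMinus aPlus; linarith
  have hα : 0 < aPlus μ := by unfold aPlus; linarith
  have hα1 : aPlus μ * (aPlus μ - 1) = -μ := by unfold aPlus; linear_combination hsq2
  have hα2 : aMinus μ * (aMinus μ - 1) = -μ := by unfold aMinus; linear_combination hsq2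
  clear hsq hsq2
  generalize aPlus μ = α at *
  generalize aMinus μ = α' at *
  have hm : 0 < (n:ℝ) - 2 + α := by linarith
  have hp1 : 0 < p - 1 := by
    have : 0 < 2 / ((n:ℝ) - 2 + α) := by positivity
    linarith
  have hk : 2 / (p - 1) < (n:ℝ) - 2 + α := by
    have h : 2 / ((n:ℝ) - 2 + α) < p - 1 := by linarith
    rw [div_lt_iff₀ hm] at h
    rw [div_lt_iff₀ hp1]
    linarith
  have hk0 : 0 < 2 / (p - 1) := by positivity
  generalize 2 / (p - 1) = k at *
  -- the main bound
  set M := c * (R / 2) ^ (-α - k) with hM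
  have hMp : 0 < M := by positivity
  have tend : ∀ γ : ℝ, 0 < γ → ∀ C : ℝ, Tendsto (fun r : ℝ => C * r ^ γ) (𝓝[>] 0) (𝓝 0) := by
    intro γ hγ C
    have : Tendsto (fun r : ℝ => C * r ^ γ) (𝓝 0) (𝓝 (C * 0 ^ γ)) :=
      ((continuousAt_rpow_const 0 γ (Or.inr hγ.le)).const_mul C).tendsto
    rw [zero_rpow hγ.ne', mul_zero] at this
    exact this.mono_left nhdsWithin_le_nhds
  have main : ∀ x : EuclideanSpace ℝ (Fin n), 0 < x1 x → ‖x‖ < R / 2 → u x ≤ M * x1 x ^ α := by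
    intro x hx hxR
    have hxn : 0 < ‖x‖ := norm_pos_iff.2 (x1_pos_ne hx)
    have step : ∀ ε > (0:ℝ), u x ≤ M * x1 x ^ α +
        ε * (GG α ((2 - n - 2 * α) / 2) x + GG α' 0 x) := by
      intro ε hε
      have er := (tend ((n:ℝ) - 2 + α - k) (by linarith) c).eventually (gt_mem_nhds hε)
      have er2 : ∀ᶠ r in 𝓝[>] (0:ℝ), r < ‖x‖ := nhdsWithin_le_nhds (gt_mem_nhds hxn)
      obtain ⟨r, ⟨hr1, hr2⟩, hr⟩ := ((er.and er2).and self_mem_nhdsWithin).exists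
      have hr : 0 < r := hr
      have es := (tend (α - α') (by linarith) (c * r ^ (-α - k))).eventually (gt_mem_nhds hε)
      have es2 : ∀ᶠ s in 𝓝[>] (0:ℝ), s < x1 x := nhdsWithin_le_nhds (gt_mem_nhds hx)
      obtain ⟨s, ⟨hs1, hs2⟩, hs⟩ := ((es.and es2).and self_mem_nhdsWithin).exists
      have hs : 0 < s := hs
      set β := (2 - (n:ℝ) - 2 * α) / 2 with hβ
      have hGG : ∀ (a b : ℝ) (y : EuclideanSpace ℝ (Fin n)), 0 < x1 y → 0 < GG a b y := by
        intro a b y hy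
        have := x1_pos_ne hy
        unfold GG
        positivity
      have hG0 : ∀ (a : ℝ) (y : EuclideanSpace ℝ (Fin n)), GG a 0 y = x1 y ^ a := by
        intro a y
        simp [GG]
      have hfin := compare (w := M • GG α 0 + ε • (GG α β + GG α' 0)) (R' := R / 2) hr (by linarith) hs
        hu hpos heq ?_ ?_ ?_ ?_ ?_ ?_ x hs2.le hr2.le hxR.le
      · simpa only [hG0, Pi.add_apply, Pi.smul_apply, smul_eq_mul] using hfin
      · intro y hy
        exact (contDiffAt_const.smul (GG_contDiffAt α 0 hy)).add
          (contDiffAt_const.smul ((GG_contDiffAt α β hy).add (GG_contDiffAt α' 0 hy)))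
      · intro y hy
        have := hGG α 0 y hy
        have := hGG α β y hy
        have := hGG α' 0 y hy
        simp only [Pi.add_apply, Pi.smul_apply, smul_eq_mul]
        positivity
      · intro y hy
        have c1 := GG_contDiffAt α 0 hy
        have c2 := GG_contDiffAt α β hy
        have c3 := GG_contDiffAt α' 0 hy
        have l1 := GG_lap hn0 α 0 hy (by ring)
        have l2 := GG_lap hn0 α β hy (by rw [hβ]; ring)
        have l3 := GG_lap hn0 α' 0 hy (by ring)
        have c4 : ContDiffAt ℝ 2 (M • GG α 0) y := contDiffAt_const.smul c1
        have c6 : ContDiffAt ℝ 2 (GG α β + GG α' 0) y := c2.add c3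
        have c5 : ContDiffAt ℝ 2 (ε • (GG α β + GG α' 0)) y := contDiffAt_const.smul (c2.add c3)
        rw [lap_eq, c4.laplacian_add c5, InnerProductSpace.laplacian_smul M c1,
          InnerProductSpace.laplacian_smul ε c6, c2.laplacian_add c3, ← lap_eq, ← lap_eq, ← lap_eq,
          l1, l2, l3, hα1, hα2]
        simp only [Pi.add_apply, Pi.smul_apply, smul_eq_mul]
        ring
      · intro y hy hyr hyR
        have g0 := hGG α 0 y hy
        have g3 := hGG α' 0 y hy
        have b := hub y ⟨hy, hyR⟩
        have : c * x1 y ^ α * ‖y‖ ^ (-α - k) ≤ ε * GG α β y := by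
          have e1 : (‖y‖ ^ 2) ^ β = r ^ (2 - (n:ℝ) - 2 * α) := by
            rw [hyr, ← rpow_natCast, ← rpow_mul hr.le]
            congr 1
            rw [hβ]; push_cast; ring
          have e2 : r ^ (-α - k) = r ^ ((n:ℝ) - 2 + α - k) * r ^ (2 - (n:ℝ) - 2 * α) := by
            rw [← rpow_add hr]; congr 1; ring
          unfold GG
          rw [e1, hyr, e2]
          have : 0 ≤ x1 y ^ α * r ^ (2 - (n:ℝ) - 2 * α) := by positivity
          nlinarith [mul_le_mul_of_nonneg_right hr1.le this]
        simp only [Pi.add_apply, Pi.smul_apply, smul_eq_mul]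
        have := mul_pos hMp g0
        have := mul_pos hε g3
        linarith
      · intro y hy hyr hyR
        have g2 := hGG α β y hy
        have g3 := hGG α' 0 y hy
        have b := hub y ⟨hy, hyR⟩
        rw [hyr] at b
        simp only [Pi.add_apply, Pi.smul_apply, smul_eq_mul]
        have := mul_pos hε (add_pos g2 g3)
        have : c * x1 y ^ α * (R / 2) ^ (-α - k) = M * GG α 0 y := by rw [hG0, hM]; ring
        linarith
      · intro y hys hyr hyR' hyR
        have hy : 0 < x1 y := by rw [hys]; exact hs
        have g1 := hGG α 0 y hy
        have g2 := hGG α β y hy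
        have b := hub y ⟨hy, hyR⟩
        have e1 : ‖y‖ ^ (-α - k) ≤ r ^ (-α - k) :=
          rpow_le_rpow_of_nonpos hr hyr (by linarith)
        have e2 : c * x1 y ^ α * ‖y‖ ^ (-α - k) ≤ c * x1 y ^ α * r ^ (-α - k) := by gcongr
        have e3 : c * x1 y ^ α * r ^ (-α - k) ≤ ε * GG α' 0 y := by
          rw [hG0, hys]
          have e4 : s ^ α = s ^ (α - α') * s ^ α' := by
            rw [← rpow_add hs]; congr 1; ring
          rw [e4]
          have : 0 ≤ s ^ α' := by positivity
          nlinarith [mul_le_mul_of_nonneg_right hs1.le this]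
        simp only [Pi.add_apply, Pi.smul_apply, smul_eq_mul]
        have := mul_pos hMp g1
        have := mul_pos hε g2
        linarith
    have ht : Tendsto (fun ε : ℝ => M * x1 x ^ α +
        ε * (GG α ((2 - n - 2 * α) / 2) x + GG α' 0 x)) (𝓝[>] 0) (𝓝 (M * x1 x ^ α)) := by
      have : ContinuousAt (fun ε : ℝ => M * x1 x ^ α +
        ε * (GG α ((2 - n - 2 * α) / 2) x + GG α' 0 x)) 0 := by fun_prop
      have := this.tendsto
      simp only [zero_mul, add_zero] at this
      exact this.mono_left nhdsWithin_le_nhds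
    refine ge_of_tendsto ht ?_
    filter_upwards [self_mem_nhdsWithin] with ε hε
    exact step ε hε
  have ev1 := (tend (α + k) (by linarith) M).eventually (gt_mem_nhds hc')
  have ev2 : ∀ᶠ t in 𝓝[>] (0:ℝ), t < min δ (R / 2) :=
    nhdsWithin_le_nhds (gt_mem_nhds (lt_min hδ (by linarith)))
  obtain ⟨t, ⟨ht1, ht2⟩, ht⟩ := ((ev1.and ev2).and self_mem_nhdsWithin).exists
  have ht : 0 < t := ht
  have ht3 := lt_of_lt_of_le ht2 (min_le_left _ _)
  have ht4 := lt_of_lt_of_le ht2 (min_le_right _ _)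
  set x : EuclideanSpace ℝ (Fin n) := EuclideanSpace.single ⟨0, hn0⟩ t with hx
  have hx1 : x1 x = t := by simp [x1, hn0, hx]
  have hxn : ‖x‖ = t := by simp [hx, abs_of_pos ht]
  have a1 := main x (by rw [hx1]; exact ht) (by rw [hxn]; exact ht4)
  have a2 := hlb x ⟨by rw [halfSpace, mem_ofPred_eq, hx1]; exact ht, by
    rw [mem_ball_zero_iff, hxn]; linarith⟩
    (by rw [hxn, hx1]; nlinarith [hκ.2]) (by rw [hxn]; exact ht3)
  rw [hxn] at a2
  rw [hx1] at a1
  have e : t ^ α = t ^ (α + k) * t ^ (-k) := by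
    rw [← rpow_add ht]; congr 1; ring
  rw [e] at a1
  have := rpow_pos_of_pos ht (-k)
  nlinarith [mul_lt_mul_of_pos_right ht1 this]
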